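/- arXiv:1305.6083 — 2 statements merged into one kernel-verified Lean document; each statement's English description precedes it below -/
import Mathlib

section
/- Let p ≥ r ≥ s ≥ 1 and let G_{(p,r,s)}(q) = Σ_{i=0}^{p+r+s} a_i q^i be the rank-generating function of arbitrary partitions contained inside the Ferrers shape (p, r, s). If 2 ≤ p ≤ 2r + s, then a_{p-1} < a_p. -/
/-- `μ` is a partition with distinct parts (strictly decreasing positive parts,
followed by a tail of zeros), encoded as a function `Fin b → ℕ`. -/
def DistinctParts {b : ℕ} (μ : Fin b → ℕ) : Prop :=
  ∀ i j : Fin b, i < j → μ j = 0 ∨ μ j < μ i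

/-- `μ` is a partition with distinct parts contained inside the shifted shape `lam`. -/
def FitsD {b : ℕ} (lam μ : Fin b → ℕ) : Prop :=
  DistinctParts μ ∧ ∀ i, μ i ≤ lam i

/-- The coefficient of `q^k` in the rank-generating function `F_lam`:
the number of partitions with distinct parts of size `k` contained inside `lam`. -/
noncomputable def Fcoeff {b : ℕ} (lam : Fin b → ℕ) (k : ℕ) : ℕ :=
  Nat.card {μ : Fin b → ℕ // FitsD lam μ ∧ ∑ i, μ i = k}

/-- The coefficient of `q^k` in the rank-generating function `G_lam` of arbitrary
partitions contained inside the straight Ferrers shape `lam`. -/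
noncomputable def Gcoeff {b : ℕ} (lam : Fin b → ℕ) (k : ℕ) : ℕ :=
  Nat.card {μ : Fin b → ℕ // Antitone μ ∧ (∀ i, μ i ≤ lam i) ∧ ∑ i, μ i = k}

/-- The coefficient of `q^i` in the Gaussian binomial coefficient `(m choose k)_q`,
which is the rank-generating function of partitions inside a `k × (m-k)` rectangle. -/
noncomputable def gaussCoeff (m k i : ℕ) : ℕ :=
  Gcoeff (fun _ : Fin k => m - k) i

theorem finite_subpartitions_of_size {b : ℕ} (lam : Fin b → ℕ) (k : ℕ) :
    Finite {μ : Fin b → ℕ // Antitone μ ∧ (∀ i, μ i ≤ lam i) ∧ ∑ i, μ i = k} :=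
  ((Set.finite_Iic lam).subset fun _ h => h.2.1).to_subtype

theorem antitone_fin_three_iff {μ : Fin 3 → ℕ} : Antitone μ ↔ μ 1 ≤ μ 0 ∧ μ 2 ≤ μ 1 := by
  rw [Fin.antitone_iff_succ_le, Fin.forall_fin_two]
  rfl

/-- Some partition `(b, b, c)` of `p`, with its two largest parts equal, fits inside `(p, r, s)`. -/
theorem exists_two_mul_add_eq {p r s : ℕ} (hsr : s ≤ r) (hs : 1 ≤ s) (hp2 : 2 ≤ p)
    (hp : p ≤ 2 * r + s) : ∃ b c, c ≤ b ∧ b ≤ r ∧ c ≤ s ∧ 2 * b + c = p := by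
  rcases le_total (2 * r) p with h | h
  · exact ⟨r, p - 2 * r, by omega, le_rfl, by omega, by omega⟩
  · exact ⟨p / 2, p % 2, by omega, by omega, by omega, by omega⟩

/-- If `p ≥ r ≥ s ≥ 1` and `2 ≤ p ≤ 2r + s`, then `a_{p-1} < a_p` for the
rank-generating function of partitions inside the shape `(p, r, s)`. -/
theorem shape_three_strict_increase (p r s : ℕ) (hrp : r ≤ p) (hsr : s ≤ r)
    (hs : 1 ≤ s) (hp2 : 2 ≤ p) (hp : p ≤ 2 * r + s) :
    Gcoeff ![p, r, s] (p - 1) < Gcoeff ![p, r, s] p := by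
  have := finite_subpartitions_of_size ![p, r, s] (p - 1)
  have := finite_subpartitions_of_size ![p, r, s] p
  have := Fintype.ofFinite
    {μ : Fin 3 → ℕ // Antitone μ ∧ (∀ i, μ i ≤ ![p, r, s] i) ∧ ∑ i, μ i = p - 1}
  have := Fintype.ofFinite
    {μ : Fin 3 → ℕ // Antitone μ ∧ (∀ i, μ i ≤ ![p, r, s] i) ∧ ∑ i, μ i = p}
  obtain ⟨b, c, hcb, hbr, hcs, hbc⟩ := exists_two_mul_add_eq hsr hs hp2 hp
  unfold Gcoeff
  rw [Nat.card_eq_fintype_card, Nat.card_eq_fintype_card]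
  refine Fintype.card_lt_of_injective_of_notMem
    (fun μ => ⟨![μ.1 0 + 1, μ.1 1, μ.1 2], ?_⟩) ?_ (b := ⟨![b, b, c], ?_⟩) ?_
  · obtain ⟨μ, hanti, hle, hsum⟩ := μ
    rw [antitone_fin_three_iff] at hanti ⊢
    simp [Fin.forall_fin_succ, Fin.sum_univ_three] at hle hsum ⊢
    omega
  · rintro ⟨μ, hμ⟩ ⟨ν, hν⟩ h
    simp at h
    ext i
    fin_cases i <;> simp [h]
  · rw [antitone_fin_three_iff]
    simp [Fin.forall_fin_succ, Fin.sum_univ_three]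
    omega
  · rintro ⟨⟨μ, hanti, hle, hsum⟩, h⟩
    rw [antitone_fin_three_iff] at hanti
    simp at h
    omega
end

section
/- If λ is any partition with distinct parts of length b ≤ 3, then the rank-generating function F_λ(q) of partitions with distinct parts contained inside λ is unimodal. -/
/-- The triples of size `k` encoding partitions with at most three distinct parts inside
`(a, b, c)`. -/
def distinctTriples (a b c k : ℕ) : Finset (ℕ × ℕ × ℕ) :=
  (Finset.range (a + 1) ×ˢ Finset.range (b + 1) ×ˢ Finset.range (c + 1)).filter
    fun p => (p.2.1 = 0 ∨ p.2.1 < p.1) ∧ (p.2.2 = 0 ∨ p.2.2 < p.2.1) ∧ p.1 + p.2.1 + p.2.2 = k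

lemma mem_distinctTriples {a b c k x y z : ℕ} :
    (x, y, z) ∈ distinctTriples a b c k ↔
      (x ≤ a ∧ y ≤ b ∧ z ≤ c) ∧ (y = 0 ∨ y < x) ∧ (z = 0 ∨ z < y) ∧ x + y + z = k := by
  simp [distinctTriples]

/-- The number of triples of size `n + 1` from which no box of the first part can be removed. -/
def gain (b c n : ℕ) : ℕ :=
  min b (n / 2) + 1 - max ((n - c + 1) / 2) (n / 3 + 1)

/-- The number of triples of size `n` whose first part is the maximal value `a`. -/
def loss (a b c n : ℕ) : ℕ :=
  if n < a then 0 else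
    min b (n - a) + 1 - max (n - a - c) (if n = a then 0 else (n - a) / 2 + 1)

lemma card_filter_minimal_first {a b c : ℕ} (hab : b < a ∨ b = 0) (n : ℕ) :
    ((distinctTriples a b c (n + 1)).filter fun p => p.1 = p.2.1 + 1 ∧ 0 < p.2.1).card =
      gain b c n := by
  rw [gain, ← Nat.card_Icc]
  refine Finset.card_bij' (fun p _ => p.2.1) (fun y _ => (y + 1, y, n - 2 * y)) ?_ ?_ ?_ ?_
  · rintro ⟨x, y, z⟩ h
    simp only [Finset.mem_filter, mem_distinctTriples] at h
    simp only [Finset.mem_Icc]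
    grind
  · intro y h
    simp only [Finset.mem_Icc] at h
    simp only [Finset.mem_filter, mem_distinctTriples]
    grind
  · rintro ⟨x, y, z⟩ h
    simp only [Finset.mem_filter, mem_distinctTriples] at h
    simp only [Prod.mk.injEq]
    grind
  · intros; rfl

lemma card_filter_maximal_first {a b c : ℕ} (hab : b < a ∨ b = 0) (n : ℕ) :
    ((distinctTriples a b c n).filter fun p => p.1 = a).card = loss a b c n := by
  rw [loss]
  split_ifs with h₁ h₂
  · rw [Finset.card_eq_zero, Finset.filter_eq_empty_iff]
    rintro ⟨x, y, z⟩ h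
    simp only [mem_distinctTriples] at h
    dsimp only
    omega
  all_goals
    rw [← Nat.card_Icc]
    refine Finset.card_bij' (fun p _ => p.2.1) (fun y _ => (a, y, n - a - y)) ?_ ?_ ?_ ?_
    · rintro ⟨x, y, z⟩ h
      simp only [Finset.mem_filter, mem_distinctTriples] at h
      simp only [Finset.mem_Icc]
      grind
    · intro y h
      simp only [Finset.mem_Icc] at h
      simp only [Finset.mem_filter, mem_distinctTriples]
      grind
    · rintro ⟨x, y, z⟩ h
      simp only [Finset.mem_filter, mem_distinctTriples] at h
      simp only [Prod.mk.injEq]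
      grind
    · intros; rfl

lemma card_distinctTriples_succ {a b c : ℕ} (hab : b < a ∨ b = 0) (n : ℕ) :
    (distinctTriples a b c (n + 1)).card + loss a b c n =
      (distinctTriples a b c n).card + gain b c n := by
  have hn := Finset.card_filter_add_card_filter_not (s := distinctTriples a b c n)
    (fun p => p.1 = a)
  have hs := Finset.card_filter_add_card_filter_not (s := distinctTriples a b c (n + 1))
    (fun p => p.1 = p.2.1 + 1 ∧ 0 < p.2.1)
  rw [card_filter_maximal_first hab] at hn
  rw [card_filter_minimal_first hab] at hs
  have hshift : ((distinctTriples a b c n).filter fun p => ¬ p.1 = a).card =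
      ((distinctTriples a b c (n + 1)).filter
        fun p => ¬ (p.1 = p.2.1 + 1 ∧ 0 < p.2.1)).card := by
    refine Finset.card_bij' (fun p _ => (p.1 + 1, p.2)) (fun p _ => (p.1 - 1, p.2)) ?_ ?_ ?_ ?_
    all_goals
      rintro ⟨x, y, z⟩ h
      simp only [Finset.mem_filter, mem_distinctTriples] at h
      simp only [Finset.mem_filter, mem_distinctTriples, Prod.mk.injEq]
      grind
  omega

lemma exists_le_gain (b c n : ℕ) : ∃ p q : ℤ, (b ≤ p ∨ n ≤ 2 * p + 1) ∧
    (2 * q ≤ n - c + 1 ∨ 3 * q ≤ n + 3) ∧ p - q + 1 ≤ gain b c n := by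
  refine ⟨(min b (n / 2) : ℕ), (max ((n - c + 1) / 2) (n / 3 + 1) : ℕ), ?_, ?_, ?_⟩
  · omega
  · omega
  · unfold gain; omega

lemma exists_gain_eq {b c n : ℕ} (h : 0 < gain b c n) : ∃ p q : ℤ, p ≤ b ∧ 2 * p ≤ n ∧
    n - c ≤ 2 * q ∧ n + 1 ≤ 3 * q ∧ (gain b c n : ℤ) = p - q + 1 := by
  refine ⟨(min b (n / 2) : ℕ), (max ((n - c + 1) / 2) (n / 3 + 1) : ℕ), ?_, ?_, ?_, ?_, ?_⟩
  · omega
  · omega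
  · omega
  · omega
  · unfold gain at *; omega

lemma exists_le_loss (b c : ℕ) {a n : ℕ} (h : a < n) : ∃ p q : ℤ, (b ≤ p ∨ n - a ≤ p) ∧
    (q ≤ n - a - c ∨ 2 * q ≤ n - a + 2) ∧ p - q + 1 ≤ loss a b c n := by
  refine ⟨(min b (n - a) : ℕ), (max (n - a - c) ((n - a) / 2 + 1) : ℕ), ?_, ?_, ?_⟩
  · omega
  · omega
  · rw [loss, if_neg (by omega), if_neg (by omega)]; omega

lemma exists_loss_eq {a b c n : ℕ} (h : 0 < loss a b c n) : ∃ p q : ℤ, a ≤ n ∧ p ≤ b ∧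
    p ≤ n - a ∧ n - a - c ≤ q ∧ (n - a + 1 ≤ 2 * q ∨ n = a ∧ p = 0 ∧ q = 0) ∧
    (loss a b c n : ℤ) = p - q + 1 := by
  refine ⟨(min b (n - a) : ℕ), (max (n - a - c) (if n = a then 0 else (n - a) / 2 + 1) : ℕ), ?_⟩
  unfold loss at *
  split_ifs at * <;> grind

/-- Once the coefficients have strictly decreased, they never strictly increase again. -/
lemma gain_le_loss_of_lt {a b c : ℕ} (hab : b < a ∨ b = 0) (hbc : c < b ∨ c = 0) {m n : ℕ}
    (hmn : m < n) (h : gain b c m < loss a b c m) : gain b c n ≤ loss a b c n := by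
  by_contra! hlt
  obtain ⟨p, q, hp, hq, hpq⟩ := exists_le_gain b c m
  obtain ⟨u, v, ham, hu, hu', hv, hv', huv⟩ := exists_loss_eq (Nat.zero_lt_of_lt h)
  obtain ⟨s, t, hs, ht, hst⟩ := exists_le_loss b c (ham.trans_lt hmn)
  obtain ⟨x, y, hx, hx', hy, hy', hxy⟩ := exists_gain_eq (Nat.zero_lt_of_lt hlt)
  have hm : p - q + 1 < u - v + 1 := by omega
  have hn : s - t + 1 < x - y + 1 := by omega
  have hm' : 0 < u - v + 1 := by omega
  have hn' : 0 < x - y + 1 := by omega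
  clear hpq huv hst hxy h hlt
  rcases hp with hp | hp <;> rcases hq with hq | hq <;> rcases hs with hs | hs <;>
    rcases ht with ht | ht <;> rcases hv' with hv' | hv' <;> omega

lemma gain_le_loss_of_size_le {a b c n : ℕ} (hab : b < a ∨ b = 0) (h : a + b + c ≤ n) :
    gain b c n ≤ loss a b c n := by
  have : gain b c n = 0 := by unfold gain; omega
  omega

lemma unimodal_card_distinctTriples {a b c : ℕ} (hab : b < a ∨ b = 0) (hbc : c < b ∨ c = 0) :
    ∃ j : ℕ, (∀ i < j, (distinctTriples a b c i).card ≤ (distinctTriples a b c (i + 1)).card) ∧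
      ∀ i, j ≤ i → (distinctTriples a b c (i + 1)).card ≤ (distinctTriples a b c i).card := by
  have hstep := fun n => card_distinctTriples_succ (c := c) hab n
  by_cases hdesc : ∃ i, gain b c i < loss a b c i
  · refine ⟨Nat.find hdesc, fun i hi => ?_, fun i hi => ?_⟩
    · have := Nat.find_min hdesc hi
      have := hstep i
      omega
    · have := hstep i
      rcases hi.eq_or_lt with rfl | hlt
      · have := Nat.find_spec hdesc
        omega
      · have := gain_le_loss_of_lt hab hbc hlt (Nat.find_spec hdesc)
        omega
  · push Not at hdesc
    refine ⟨a + b + c, fun i _ => ?_, fun i hi => ?_⟩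
    · have := hstep i
      have := hdesc i
      omega
    · have := hstep i
      have := gain_le_loss_of_size_le hab hi
      omega

/-- A shape with at most three parts, padded by zeros, has its partitions counted by triples. -/
lemma Fcoeff_eq_card_distinctTriples {b : ℕ} (hb : b ≤ 3) (lam : Fin b → ℕ) {l : Fin 3 → ℕ}
    (hl : ∀ i, l i = if h : i.val < b then lam ⟨i, h⟩ else 0) (k : ℕ) :
    Fcoeff lam k = (distinctTriples (l 0) (l 1) (l 2) k).card := by
  have h0 := hl 0
  have h1 := hl 1
  have h2 := hl 2
  rw [Fcoeff, ← Finset.card_image_of_injOn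
    (f := fun p : ℕ × ℕ × ℕ => fun i : Fin b => ![p.1, p.2.1, p.2.2] (Fin.castLE hb i))]
  · refine Nat.subtype_card _ fun μ => ?_
    simp only [Finset.mem_image, Prod.exists, mem_distinctTriples, FitsD, DistinctParts]
    interval_cases b
    all_goals simp [Fin.forall_fin_succ, Fin.sum_univ_succ, funext_iff] at h0 h1 h2 ⊢
    · exact ⟨by rintro ⟨x, y, z, h⟩; omega, fun h => ⟨0, 0, 0, by omega⟩⟩
    · exact ⟨by rintro ⟨x, y, h⟩; omega, fun h => ⟨0, 0, by omega⟩⟩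
    · exact ⟨by rintro ⟨x, h⟩; omega, fun h => ⟨0, by omega⟩⟩
    · omega
  · rintro ⟨x, y, z⟩ h ⟨x', y', z'⟩ h' heq
    simp only [Finset.mem_coe, mem_distinctTriples] at h h'
    interval_cases b
    all_goals simp [Fin.forall_fin_succ, funext_iff] at h0 h1 h2 heq ⊢
    all_goals omega

/-- If `λ` has at most three (distinct, positive, strictly decreasing) parts, then
the rank-generating function `F_λ` is unimodal. -/
theorem three_parts_unimodal (b : ℕ) (hb : b ≤ 3) (lam : Fin b → ℕ)
    (hpos : ∀ i, 0 < lam i) (hdec : StrictAnti lam) :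
    ∃ j : ℕ, (∀ i < j, Fcoeff lam i ≤ Fcoeff lam (i + 1)) ∧
      (∀ i, j ≤ i → Fcoeff lam (i + 1) ≤ Fcoeff lam i) := by
  simp only [Fcoeff_eq_card_distinctTriples hb lam fun _ => rfl]
  apply unimodal_card_distinctTriples
  · by_cases h : 1 < b
    · left
      simpa [h, show 0 < b by omega] using hdec (show (⟨0, by omega⟩ : Fin b) < ⟨1, h⟩ by simp)
    · simp [h]
  · by_cases h : 2 < b
    · left
      simpa [h, show 1 < b by omega] using hdec (show (⟨1, by omega⟩ : Fin b) < ⟨2, h⟩ by simp)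
    · simp [h]
end
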